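/- Karush–Kuhn–Tucker complementarity for the von Mises return mapping: for every strain ε_k ∈ Sym(3) one has Δλ(ε_k) ≥ 0, Ψ(T_k(ε_k), β_k(ε_k)) ≤ 0, and Δλ(ε_k) · Ψ(T_k(ε_k), β_k(ε_k)) = 0; in particular the returned stress is always admissible. -/

import Mathlib

open Matrix

/-- Frobenius inner product on 3×3 real matrices. -/
noncomputable def frob (σ τ : Matrix (Fin 3) (Fin 3) ℝ) : ℝ := ∑ i, ∑ j, σ i j * τ i j

/-- Frobenius norm. -/
noncomputable def fnorm (τ : Matrix (Fin 3) (Fin 3) ℝ) : ℝ := Real.sqrt (frob τ τ)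

/-- Deviatoric part. -/
noncomputable def devM (τ : Matrix (Fin 3) (Fin 3) ℝ) : Matrix (Fin 3) (Fin 3) ℝ :=
  τ - (Matrix.trace τ / 3) • (1 : Matrix (Fin 3) (Fin 3) ℝ)

/-- The isotropic elasticity tensor `ℂε = K tr(ε) I + 2G dev(ε)`. -/
noncomputable def Celast (K G : ℝ) (ε : Matrix (Fin 3) (Fin 3) ℝ) : Matrix (Fin 3) (Fin 3) ℝ :=
  (K * Matrix.trace ε) • (1 : Matrix (Fin 3) (Fin 3) ℝ) + (2 * G) • devM ε

/-- Trial deviatoric stress `s^tr(ε) = dev(ℂ(ε − εₖ₋₁ᵖ)) − βₖ₋₁`. -/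
noncomputable def strVM (K G : ℝ) (εp βp ε : Matrix (Fin 3) (Fin 3) ℝ) :
    Matrix (Fin 3) (Fin 3) ℝ :=
  devM (Celast K G (ε - εp)) - βp

/-- Plastic multiplier `Δλ(ε) = max(|s^tr| − Y, 0)/(2G + a)`. -/
noncomputable def dLamVM (K G a Y : ℝ) (εp βp ε : Matrix (Fin 3) (Fin 3) ℝ) : ℝ :=
  max (fnorm (strVM K G εp βp ε) - Y) 0 / (2 * G + a)

/-- The von Mises stress-strain operator `T_k`. -/
noncomputable def TVM (K G a Y : ℝ) (εp βp ε : Matrix (Fin 3) (Fin 3) ℝ) :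
    Matrix (Fin 3) (Fin 3) ℝ :=
  if fnorm (strVM K G εp βp ε) ≤ Y then Celast K G (ε - εp)
  else Celast K G (ε - εp) -
    (2 * G * dLamVM K G a Y εp βp ε) • ((fnorm (strVM K G εp βp ε))⁻¹ • strVM K G εp βp ε)

/-- The updated back-stress `βₖ(ε)`. -/
noncomputable def betaVM (K G a Y : ℝ) (εp βp ε : Matrix (Fin 3) (Fin 3) ℝ) :
    Matrix (Fin 3) (Fin 3) ℝ :=
  if fnorm (strVM K G εp βp ε) ≤ Y then βp
  else βp + (a * dLamVM K G a Y εp βp ε) • ((fnorm (strVM K G εp βp ε))⁻¹ • strVM K G εp βp ε)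

/-- The von Mises yield function `Ψ(τσ, τβ) = |dev(τσ − τβ)| − Y`. -/
noncomputable def PsiVM (Y : ℝ) (τσ τβ : Matrix (Fin 3) (Fin 3) ℝ) : ℝ :=
  fnorm (devM (τσ - τβ)) - Y

theorem fnorm_smul (c : ℝ) (τ : Matrix (Fin 3) (Fin 3) ℝ) :
    fnorm (c • τ) = |c| * fnorm τ := by
  have h : frob (c • τ) (c • τ) = c ^ 2 * frob τ τ := by
    simp only [frob, Matrix.smul_apply, smul_eq_mul, Finset.mul_sum]
    exact Finset.sum_congr rfl fun i _ => Finset.sum_congr rfl fun j _ => by ring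
  rw [fnorm, h, Real.sqrt_mul (sq_nonneg c), Real.sqrt_sq_eq_abs, fnorm]

theorem devM_sub (σ τ : Matrix (Fin 3) (Fin 3) ℝ) : devM (σ - τ) = devM σ - devM τ := by
  simp only [devM, Matrix.trace_sub]
  module

theorem devM_of_trace_eq_zero {τ : Matrix (Fin 3) (Fin 3) ℝ} (h : τ.trace = 0) :
    devM τ = τ := by
  simp [devM, h]

theorem trace_devM (τ : Matrix (Fin 3) (Fin 3) ℝ) : (devM τ).trace = 0 := by
  simp only [devM, Matrix.trace_sub, Matrix.trace_smul, Matrix.trace_one, Fintype.card_fin,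
    smul_eq_mul]
  push_cast
  ring

theorem trace_strVM (K G : ℝ) (εp ε : Matrix (Fin 3) (Fin 3) ℝ)
    {βp : Matrix (Fin 3) (Fin 3) ℝ} (hβ : βp.trace = 0) : (strVM K G εp βp ε).trace = 0 := by
  simp [strVM, Matrix.trace_sub, trace_devM, hβ]

/-- In the elastic regime the relative stress is the trial one. -/
theorem PsiVM_of_le {K G a Y : ℝ} {εp βp ε : Matrix (Fin 3) (Fin 3) ℝ} (hβ : βp.trace = 0)
    (h : fnorm (strVM K G εp βp ε) ≤ Y) :
    PsiVM Y (TVM K G a Y εp βp ε) (betaVM K G a Y εp βp ε) = fnorm (strVM K G εp βp ε) - Y := by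
  rw [PsiVM, TVM, betaVM, if_pos h, if_pos h, devM_sub, devM_of_trace_eq_zero hβ, strVM]

/-- In the plastic regime the returned stress lies on the yield surface. -/
theorem PsiVM_of_lt {K G a Y : ℝ} {εp βp ε : Matrix (Fin 3) (Fin 3) ℝ} (hGa : 2 * G + a ≠ 0)
    (hY : 0 ≤ Y) (hβ : βp.trace = 0) (h : Y < fnorm (strVM K G εp βp ε)) :
    PsiVM Y (TVM K G a Y εp βp ε) (betaVM K G a Y εp βp ε) = 0 := by
  have hs := trace_strVM K G εp ε hβ
  have hlam : (2 * G + a) * dLamVM K G a Y εp βp ε = fnorm (strVM K G εp βp ε) - Y := by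
    rw [dLamVM, max_eq_left (sub_nonneg.2 h.le), mul_div_cancel₀ _ hGa]
  have hdev : devM (Celast K G (ε - εp)) = strVM K G εp βp ε + βp := by simp [strVM]
  have hN : 0 < fnorm (strVM K G εp βp ε) := hY.trans_lt h
  rw [PsiVM, TVM, betaVM, if_neg h.not_ge, if_neg h.not_ge]
  generalize strVM K G εp βp ε = s at *
  generalize dLamVM K G a Y εp βp ε = l at *
  have hrel : devM (Celast K G (ε - εp) - (2 * G * l) • ((fnorm s)⁻¹ • s) -
      (βp + (a * l) • ((fnorm s)⁻¹ • s))) = (Y / fnorm s) • s := by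
    rw [devM_sub, devM_sub, devM_of_trace_eq_zero (τ := (2 * G * l) • _) (by simp [hs]),
      devM_of_trace_eq_zero (τ := βp + _) (by simp [hs, hβ]), hdev]
    have hc : Y / fnorm s = 1 - (2 * G + a) * l * (fnorm s)⁻¹ := by
      rw [hlam]
      field_simp
      ring
    rw [hc]
    module
  rw [hrel, fnorm_smul, abs_of_nonneg (by positivity), div_mul_cancel₀ _ hN.ne', sub_self]

/-- Karush–Kuhn–Tucker complementarity for the von Mises return mapping: for every strain
`εₖ` one has `Δλ ≥ 0`, `Ψ(Tₖ(εₖ), βₖ(εₖ)) ≤ 0` and `Δλ · Ψ(Tₖ(εₖ), βₖ(εₖ)) = 0`;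
in particular the returned stress is always admissible. -/
theorem vonMises_KKT (K G a Y : ℝ) (hK : 0 < K) (hG : 0 < G) (ha : 0 < a) (hY : 0 < Y)
    (εp βp : Matrix (Fin 3) (Fin 3) ℝ) (hεp : εp.IsSymm) (hβp : βp.IsSymm)
    (hβtr : Matrix.trace βp = 0) :
    ∀ εk : Matrix (Fin 3) (Fin 3) ℝ, εk.IsSymm →
      0 ≤ dLamVM K G a Y εp βp εk ∧
      PsiVM Y (TVM K G a Y εp βp εk) (betaVM K G a Y εp βp εk) ≤ 0 ∧
      dLamVM K G a Y εp βp εk * PsiVM Y (TVM K G a Y εp βp εk) (betaVM K G a Y εp βp εk) = 0 := by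
  intro εk _
  have hGa : 0 < 2 * G + a := by positivity
  refine ⟨div_nonneg (le_max_right _ _) hGa.le, ?_⟩
  rcases le_or_gt (fnorm (strVM K G εp βp εk)) Y with h | h
  · rw [PsiVM_of_le hβtr h, dLamVM, max_eq_right (sub_nonpos.2 h), zero_div, zero_mul]
    exact ⟨sub_nonpos.2 h, rfl⟩
  · rw [PsiVM_of_lt hGa.ne' hY.le hβtr h, mul_zero]
    exact ⟨le_rfl, rfl⟩
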